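/- arXiv:2412.15996 — 3 statements merged into one kernel-verified Lean document; each statement's English description precedes it below -/
import Mathlib

section
/- Let n ≥ 1, m > 0, and let φ : ℝ × ℝ^n → ℂ be a function satisfying φ(u+α, y) = e^{−i m α} φ(u,y) for all u, α ∈ ℝ and y ∈ ℝ^n, such that A(y) := φ(0,y) is smooth and compactly supported. Define Φ : ℝ^{1,n} → ℂ by the integral over the cut of Ti⁺ determined by X: Φ(X) = (m/(2π))^{n/2} ∫_{ℝ^n} (1+|y|²)^{−1/2} ( φ(−η(X,P̃(y)), y) + conj( φ(−η(X,P̃(y)), y) ) ) dy. Then Φ is smooth and satisfies the massive Klein–Gordon equation: −∂₀²Φ + Σ_{i=1}^n ∂ᵢ²Φ = m² Φ on all of ℝ^{1,n}. -/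
open scoped BigOperators
open Filter MeasureTheory

noncomputable section

/-- Minkowski inner product on `ℝ^{1,n}` (mostly plus signature). -/
def minkowski (n : ℕ) (X Y : Fin (n+1) → ℝ) : ℝ :=
  -(X 0 * Y 0) + ∑ i : Fin n, X i.succ * Y i.succ

/-- Parametrization of the future unit hyperboloid `H^n ⊂ ℝ^{1,n}`. -/
def hyp (n : ℕ) (y : Fin n → ℝ) : Fin (n+1) → ℝ :=
  Fin.cons (Real.sqrt (1 + ∑ i, y i ^ 2)) y

/-- Partial derivative in the `i`-th coordinate direction. -/
def pdv {m : ℕ} {F : Type*} [NormedAddCommGroup F] [NormedSpace ℝ F]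
    (i : Fin m) (f : (Fin m → ℝ) → F) (x : Fin m → ℝ) : F :=
  fderiv ℝ f x (Pi.single i 1)

/-- The oscillatory integral `X ↦ ∫ exp(i q(y) X) f(y) dμ(y)` with a phase linear in `X`. -/
def oscInt {Y V E : Type*} [MeasurableSpace Y] [NormedAddCommGroup V] [NormedSpace ℝ V]
    [NormedAddCommGroup E] [NormedSpace ℝ E] [NormedSpace ℂ E]
    (μ : Measure Y) (q : Y → V →L[ℝ] ℝ) (f : Y → E) (X : V) : E :=
  ∫ y, Complex.exp (Complex.I * (q y X : ℂ)) • f y ∂μ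

section OscInt

variable {Y V E : Type*} [TopologicalSpace Y] [NormedAddCommGroup V] [NormedSpace ℝ V]
  [NormedAddCommGroup E] [NormedSpace ℂ E] {q : Y → V →L[ℝ] ℝ} {f : Y → E}

lemma continuous_exp_smul (hq : Continuous q) (hf : Continuous f) (X : V) :
    Continuous fun y => Complex.exp (Complex.I * (q y X : ℂ)) • f y := by
  have h : Continuous fun y => q y X := hq.clm_apply continuous_const
  fun_prop

lemma norm_exp_I_mul_smul (t : ℝ) (e : E) :
    ‖Complex.exp (Complex.I * (t : ℂ)) • e‖ = ‖e‖ := by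
  rw [norm_smul, mul_comm Complex.I, Complex.norm_exp_ofReal_mul_I, one_mul]

lemma continuous_smulRight_I [NormedSpace ℝ E] (hq : Continuous q) (hf : Continuous f) :
    Continuous fun y => (q y).smulRight (Complex.I • f y) :=
  ((ContinuousLinearMap.smulRightL ℝ V E).continuous.comp hq).clm_apply
    (hf.const_smul Complex.I)

lemma hasCompactSupport_smulRight_I [NormedSpace ℝ E] (hs : HasCompactSupport f) :
    HasCompactSupport fun y => (q y).smulRight (Complex.I • f y) :=
  hs.mono fun y hy hfy => hy <| by
    ext v
    simp [hfy]

variable [MeasurableSpace Y] [BorelSpace Y] {μ : Measure Y} [IsFiniteMeasureOnCompacts μ]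

lemma integrable_exp_smul (hq : Continuous q) (hf : Continuous f) (hs : HasCompactSupport f)
    (X : V) : Integrable (fun y => Complex.exp (Complex.I * (q y X : ℂ)) • f y) μ :=
  (continuous_exp_smul hq hf X).integrable_of_hasCompactSupport hs.smul_left

variable [SecondCountableTopology Y] [NormedSpace ℝ E] [IsScalarTower ℝ ℂ E]

lemma hasFDerivAt_oscInt (hq : Continuous q) (hf : Continuous f) (hs : HasCompactSupport f)
    (X : V) :
    HasFDerivAt (oscInt μ q f)
      (oscInt μ q (fun y => (q y).smulRight (Complex.I • f y)) X) X := by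
  have hf' := continuous_smulRight_I hq hf
  have hs' := hasCompactSupport_smulRight_I (q := q) hs
  refine hasFDerivAt_integral_of_dominated_of_fderiv_le (s := Set.univ)
    (F' := fun X' y =>
      Complex.exp (Complex.I * (q y X' : ℂ)) • (q y).smulRight (Complex.I • f y))
    (bound := fun y => ‖(q y).smulRight (Complex.I • f y)‖) univ_mem
    (Eventually.of_forall fun X' => (continuous_exp_smul hq hf X').aestronglyMeasurable)
    (integrable_exp_smul hq hf hs X)
    (continuous_exp_smul hq hf' X).aestronglyMeasurable
    (Eventually.of_forall fun y X' _ => (norm_exp_I_mul_smul (E := V →L[ℝ] E) _ _).le)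
    (hf'.integrable_of_hasCompactSupport hs').norm
    (Eventually.of_forall fun y X' _ => ?_)
  have h1 : HasFDerivAt (fun X' : V => Complex.I * (q y X' : ℂ))
      (Complex.I • (Complex.ofRealCLM.comp (q y))) X' :=
    (Complex.ofRealCLM.hasFDerivAt.comp X' (q y).hasFDerivAt).const_mul Complex.I
  convert h1.cexp.smul_const (f y) using 1
  ext v
  simp only [smul_apply, ContinuousLinearMap.smulRight_apply,
    ContinuousLinearMap.comp_apply, Complex.ofRealCLM_apply, smul_eq_mul]
  rw [← algebraMap_smul ℂ (q y v) (Complex.I • f y), Complex.coe_algebraMap, smul_smul, smul_smul,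
    mul_assoc, mul_comm (q y v : ℂ)]

end OscInt

lemma contDiff_oscInt_nat {Y V : Type} [TopologicalSpace Y] [SecondCountableTopology Y]
    [MeasurableSpace Y] [BorelSpace Y] {μ : Measure Y} [IsFiniteMeasureOnCompacts μ]
    [NormedAddCommGroup V] [NormedSpace ℝ V] {q : Y → V →L[ℝ] ℝ} (hq : Continuous q) (k : ℕ)
    {E : Type} [NormedAddCommGroup E] [NormedSpace ℝ E] [NormedSpace ℂ E] [IsScalarTower ℝ ℂ E]
    {f : Y → E} (hf : Continuous f) (hs : HasCompactSupport f) :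
    ContDiff ℝ k (oscInt μ q f) := by
  induction k generalizing E with
  | zero =>
    exact contDiff_zero.2 <| continuous_iff_continuousAt.2 fun X =>
      (hasFDerivAt_oscInt hq hf hs X).continuousAt
  | succ k ih =>
    exact contDiff_succ_iff_hasFDerivAt.2 ⟨_, ih (continuous_smulRight_I hq hf)
      (hasCompactSupport_smulRight_I hs), hasFDerivAt_oscInt hq hf hs⟩

lemma contDiff_oscInt {Y V E : Type} [TopologicalSpace Y] [SecondCountableTopology Y]
    [MeasurableSpace Y] [BorelSpace Y] {μ : Measure Y} [IsFiniteMeasureOnCompacts μ]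
    [NormedAddCommGroup V] [NormedSpace ℝ V] {q : Y → V →L[ℝ] ℝ} (hq : Continuous q)
    [NormedAddCommGroup E] [NormedSpace ℝ E] [NormedSpace ℂ E] [IsScalarTower ℝ ℂ E]
    {f : Y → E} (hf : Continuous f) (hs : HasCompactSupport f) :
    ContDiff ℝ (⊤ : ℕ∞) (oscInt μ q f) :=
  contDiff_infty.2 fun k => contDiff_oscInt_nat hq k hf hs

section PartialDerivatives

variable {Y : Type*} [TopologicalSpace Y] [SecondCountableTopology Y] [MeasurableSpace Y]
  [BorelSpace Y] {μ : Measure Y} [IsFiniteMeasureOnCompacts μ] {d : ℕ}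
  {q : Y → (Fin d → ℝ) →L[ℝ] ℝ} {f : Y → ℂ}

lemma pdv_oscInt (hq : Continuous q) (hf : Continuous f) (hs : HasCompactSupport f)
    (i : Fin d) :
    pdv i (oscInt μ q f) = oscInt μ q fun y => q y (Pi.single i 1) * (Complex.I * f y) := by
  funext X
  rw [pdv, (hasFDerivAt_oscInt hq hf hs X).fderiv, oscInt, oscInt,
    ContinuousLinearMap.integral_apply (integrable_exp_smul hq (continuous_smulRight_I hq hf)
      (hasCompactSupport_smulRight_I hs) X)]
  simp

lemma pdv_pdv_oscInt (hq : Continuous q) (hf : Continuous f) (hs : HasCompactSupport f)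
    (i : Fin d) :
    pdv i (pdv i (oscInt μ q f)) =
      oscInt μ q fun y => -(q y (Pi.single i 1) : ℂ) ^ 2 * f y := by
  have hqi : Continuous fun y => q y (Pi.single i 1) := hq.clm_apply continuous_const
  rw [pdv_oscInt hq hf hs, pdv_oscInt hq (f := fun y => q y (Pi.single i 1) * (Complex.I * f y))
    (by fun_prop) hs.mul_left.mul_left]
  congr 1
  funext y
  linear_combination (q y (Pi.single i 1) : ℂ) ^ 2 * f y * Complex.I_sq

end PartialDerivatives

lemma pdv_const_mul_add {d : ℕ} {g h : (Fin d → ℝ) → ℂ} (c : ℂ)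
    (hg : Differentiable ℝ g) (hh : Differentiable ℝ h) (i : Fin d) :
    pdv i (fun X => c * (g X + h X)) = fun X => c * (pdv i g X + pdv i h X) := by
  funext X
  have h : HasFDerivAt (fun X => c * (g X + h X)) (c • (fderiv ℝ g X + fderiv ℝ h X)) X :=
    ((hg X).hasFDerivAt.add (hh X).hasFDerivAt).const_mul c
  rw [pdv, h.fderiv]
  simp [pdv, mul_add]

lemma contDiff_pdv {d : ℕ} {g : (Fin d → ℝ) → ℂ} (hg : ContDiff ℝ (⊤ : ℕ∞) g) (i : Fin d) :
    ContDiff ℝ (⊤ : ℕ∞) (pdv i g) :=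
  (hg.fderiv_right (m := (⊤ : ℕ∞)) (by simp)).clm_apply contDiff_const

/-- An oscillatory integral over phases on the mass shell solves the Klein–Gordon equation. -/
lemma klein_gordon_oscInt {Y : Type*} [TopologicalSpace Y] [SecondCountableTopology Y]
    [MeasurableSpace Y] [BorelSpace Y] {μ : Measure Y} [IsFiniteMeasureOnCompacts μ] {n : ℕ}
    {q : Y → (Fin (n + 1) → ℝ) →L[ℝ] ℝ} {f : Y → ℂ} (hq : Continuous q) (hf : Continuous f)
    (hs : HasCompactSupport f) (m : ℝ)
    (hm : ∀ y, q y (Pi.single 0 1) ^ 2 - ∑ i : Fin n, q y (Pi.single i.succ 1) ^ 2 = m ^ 2)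
    (X : Fin (n + 1) → ℝ) :
    -(pdv 0 (pdv 0 (oscInt μ q f)) X) + ∑ i : Fin n, pdv i.succ (pdv i.succ (oscInt μ q f)) X =
      (m : ℂ) ^ 2 * oscInt μ q f X := by
  set F : Fin (n + 1) → Y → ℂ := fun i y =>
    Complex.exp (Complex.I * (q y X : ℂ)) • (-(q y (Pi.single i 1) : ℂ) ^ 2 * f y) with hF
  have hint (i : Fin (n + 1)) : Integrable (F i) μ := by
    have hqi : Continuous fun y => q y (Pi.single i 1) := hq.clm_apply continuous_const
    exact integrable_exp_smul hq (by fun_prop) hs.mul_left X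
  have hpdv (i : Fin (n + 1)) : pdv i (pdv i (oscInt μ q f)) X = ∫ y, F i y ∂μ := by
    rw [pdv_pdv_oscInt hq hf hs, oscInt]
  simp only [hpdv]
  rw [← integral_neg, ← integral_finsetSum _ fun i _ => hint i.succ,
    ← integral_add (hint 0).fun_neg (integrable_finsetSum _ fun i _ => hint i.succ), oscInt,
    ← integral_const_mul]
  refine integral_congr_ae (Eventually.of_forall fun y => ?_)
  have hy : (q y (Pi.single 0 1) : ℂ) ^ 2 - ∑ i : Fin n, (q y (Pi.single i.succ 1) : ℂ) ^ 2
      = (m : ℂ) ^ 2 := by exact_mod_cast hm y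
  simp only [hF, smul_eq_mul, neg_mul, mul_neg, Finset.sum_neg_distrib, ← hy, ← Finset.sum_mul,
    ← Finset.mul_sum]
  ring

/-- The covector `X ↦ s · η(X, P̃(y))`. -/
def massShell (n : ℕ) (s : ℝ) (y : Fin n → ℝ) : (Fin (n + 1) → ℝ) →L[ℝ] ℝ :=
  s • (-(Real.sqrt (1 + ∑ i, y i ^ 2) • ContinuousLinearMap.proj (R := ℝ) 0)
    + ∑ i : Fin n, y i • ContinuousLinearMap.proj (R := ℝ) i.succ)

lemma massShell_apply (n : ℕ) (s : ℝ) (y : Fin n → ℝ) (X : Fin (n + 1) → ℝ) :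
    massShell n s y X = s * minkowski n X (hyp n y) := by
  simp [massShell, minkowski, hyp, mul_comm, mul_add]

lemma continuous_massShell (n : ℕ) (s : ℝ) : Continuous (massShell n s) := by
  unfold massShell
  fun_prop

lemma massShell_sq (n : ℕ) (s : ℝ) (y : Fin n → ℝ) :
    massShell n s y (Pi.single 0 1) ^ 2
      - ∑ i : Fin n, massShell n s y (Pi.single i.succ 1) ^ 2 = s ^ 2 := by
  have h0 : massShell n s y (Pi.single 0 1) = -(s * Real.sqrt (1 + ∑ i, y i ^ 2)) := by
    simp [massShell, Fin.succ_ne_zero]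
  have hi (i : Fin n) : massShell n s y (Pi.single i.succ 1) = s * y i := by
    simp [massShell, Pi.single_apply, (Fin.succ_ne_zero _).symm]
  simp only [h0, hi, neg_sq, mul_pow, ← Finset.mul_sum]
  rw [Real.sq_sqrt (by positivity)]
  ring

/-- Given scattering data `φ` on `Ti⁺` (equivariant under the `ℝ`-action with mass `m`,
with smooth compactly supported amplitude), the field `Φ` reconstructed by integrating
`φ + φ†` over the cuts of `Ti⁺` is smooth and satisfies the massive Klein–Gordon equation
`-∂₀²Φ + Σᵢ ∂ᵢ²Φ = m²Φ`. -/
theorem reconstruction_solves_klein_gordon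
    (n : ℕ) (hn : 1 ≤ n) (m : ℝ) (hm : 0 < m)
    (φ : ℝ × (Fin n → ℝ) → ℂ)
    (hφ : ∀ (u α : ℝ) (y : Fin n → ℝ),
      φ (u + α, y) = Complex.exp (-(Complex.I * (m : ℂ) * (α : ℂ))) * φ (u, y))
    (hA : ContDiff ℝ (⊤ : ℕ∞) (fun y : Fin n → ℝ => φ (0, y)))
    (hAsupp : HasCompactSupport (fun y : Fin n → ℝ => φ (0, y)))
    (Φ : (Fin (n+1) → ℝ) → ℂ)
    (hΦ : ∀ X, Φ X = (((m / (2 * Real.pi)) ^ ((n:ℝ)/2) : ℝ) : ℂ) *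
      ∫ y : Fin n → ℝ,
        (((1 + ∑ i, y i ^ 2 : ℝ) ^ (-(1:ℝ)/2) : ℝ) : ℂ) *
          (φ (-(minkowski n X (hyp n y)), y)
            + (starRingEnd ℂ) (φ (-(minkowski n X (hyp n y)), y)))) :
    ContDiff ℝ (⊤ : ℕ∞) Φ ∧
      ∀ X, -(pdv (0 : Fin (n+1)) (pdv (0 : Fin (n+1)) Φ) X)
          + ∑ i : Fin n, pdv i.succ (pdv i.succ Φ) X = (m : ℂ)^2 * Φ X := by
  set A : (Fin n → ℝ) → ℂ := fun y => φ (0, y) with hAdef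
  set c : ℂ := (((m / (2 * Real.pi)) ^ ((n:ℝ)/2) : ℝ) : ℂ)
  set w : (Fin n → ℝ) → ℂ := fun y => (((1 + ∑ i, y i ^ 2 : ℝ) ^ (-(1:ℝ)/2) : ℝ) : ℂ) with hw
  have hwc : Continuous w := by
    refine Complex.continuous_ofReal.comp (Continuous.rpow_const (by fun_prop) fun y => Or.inl ?_)
    positivity
  have hAc : Continuous A := hA.continuous
  have hf₁ : Continuous fun y => w y * A y := hwc.mul hAc
  have hf₂ : Continuous fun y => w y * (starRingEnd ℂ) (A y) :=
    hwc.mul (Complex.continuous_conj.comp hAc)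
  have hs₁ : HasCompactSupport fun y => w y * A y := hAsupp.mul_left
  have hs₂ : HasCompactSupport fun y => w y * (starRingEnd ℂ) (A y) :=
    (hAsupp.comp_left (map_zero (starRingEnd ℂ))).mul_left
  set G₁ := oscInt volume (massShell n m) fun y => w y * A y with hG₁
  set G₂ := oscInt volume (massShell n (-m)) fun y => w y * (starRingEnd ℂ) (A y) with hG₂
  have hc₁ : ContDiff ℝ (⊤ : ℕ∞) G₁ := contDiff_oscInt (continuous_massShell n m) hf₁ hs₁
  have hc₂ : ContDiff ℝ (⊤ : ℕ∞) G₂ := contDiff_oscInt (continuous_massShell n (-m)) hf₂ hs₂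
  have hΦG : Φ = fun X => c * (G₁ X + G₂ X) := by
    funext X
    rw [hΦ, hG₁, hG₂, oscInt, oscInt, ← integral_add
      (integrable_exp_smul (continuous_massShell n m) hf₁ hs₁ X)
      (integrable_exp_smul (continuous_massShell n (-m)) hf₂ hs₂ X)]
    congr 1
    refine integral_congr_ae (Eventually.of_forall fun y => ?_)
    have h := hφ 0 (-(minkowski n X (hyp n y))) y
    rw [zero_add] at h
    simp only [h, massShell_apply, map_mul, ← Complex.exp_conj, map_neg, Complex.conj_I,
      Complex.conj_ofReal, smul_eq_mul, hw, hAdef]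
    push_cast
    ring_nf
  have hd {g : (Fin (n + 1) → ℝ) → ℂ} (hg : ContDiff ℝ (⊤ : ℕ∞) g) : Differentiable ℝ g :=
    hg.differentiable (by simp)
  subst hΦG
  refine ⟨contDiff_const.mul (hc₁.add hc₂), fun X => ?_⟩
  have hkg₁ := klein_gordon_oscInt (μ := volume) (continuous_massShell n m) hf₁ hs₁ m
    (massShell_sq n m) X
  have hkg₂ := klein_gordon_oscInt (μ := volume) (continuous_massShell n (-m)) hf₂ hs₂ m
    (fun y => by rw [massShell_sq, neg_sq]) X
  rw [← hG₁] at hkg₁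
  rw [← hG₂] at hkg₂
  simp only [pdv_const_mul_add c (hd hc₁) (hd hc₂),
    pdv_const_mul_add c (hd (contDiff_pdv hc₁ _)) (hd (contDiff_pdv hc₂ _)),
    ← Finset.mul_sum, Finset.sum_add_distrib]
  linear_combination c * (hkg₁ + hkg₂)
end
end

section
/- Let n ≥ 1, X ∈ ℝ^{1,n} and k ∈ ℝ^n. Then there exists s₀ > 0 such that for all s > s₀ the point X + s P̃(k) lies in the interior of the future light cone, and the following asymptotics hold as s → ∞: (i) lim_{s→∞} s² ( ρ(X + s P̃(k)) − 1/s ) = η(X, P̃(k)); (ii) lim_{s→∞} ρ(X + s P̃(k)) · ( Xⁱ + s P̃ⁱ(k) )_{i=1,…,n} = k. Consequently, every timelike geodesic s ↦ X + s P̃(k) reaches the boundary point y = k with boundary defining function ρ_X = ρ − ρ² η(X,P̃(y)) + O(ρ³), i.e. the spacetime point X determines the cut of Ti⁺ given by u = −η(X, P̃(y)). -/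
open scoped BigOperators
open Filter MeasureTheory

noncomputable section

/-- The boundary defining function `ρ(X) = (-η(X,X))^{-1/2}` on the interior of the
future light cone. -/
def rho (n : ℕ) (X : Fin (n+1) → ℝ) : ℝ := (Real.sqrt (-(minkowski n X X)))⁻¹

/-- `P̃(k)` is a unit timelike vector, so `-η` is a monic quadratic along the geodesic. -/
lemma neg_minkowski_add_smul_hyp (n : ℕ) (X : Fin (n+1) → ℝ) (k : Fin n → ℝ) (s : ℝ) :
    -minkowski n (X + s • hyp n k) (X + s • hyp n k) =
      s ^ 2 - 2 * minkowski n X (hyp n k) * s - minkowski n X X := by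
  have hsq : Real.sqrt (1 + ∑ i, k i ^ 2) ^ 2 = 1 + ∑ i, k i ^ 2 :=
    Real.sq_sqrt (by positivity)
  have hsum : ∑ i : Fin n, (X i.succ + s * k i) * (X i.succ + s * k i) =
      ∑ i : Fin n, X i.succ * X i.succ + 2 * s * ∑ i : Fin n, X i.succ * k i +
        s ^ 2 * ∑ i, k i ^ 2 := by
    simp only [Finset.mul_sum, ← Finset.sum_add_distrib]
    exact Finset.sum_congr rfl fun i _ => by ring
  simp only [minkowski, hyp, Pi.add_apply, Pi.smul_apply, smul_eq_mul, Fin.cons_zero,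
    Fin.cons_succ, hsum]
  linear_combination s ^ 2 * hsq

lemma tendsto_add_mul_inv_atTop (a b : ℝ) :
    Tendsto (fun s : ℝ => a + b * s⁻¹) atTop (nhds a) := by
  simpa using (tendsto_inv_atTop_zero.const_mul b).const_add a

lemma eventually_quadratic_pos (a b : ℝ) : ∀ᶠ s : ℝ in atTop, 0 < s ^ 2 - 2 * b * s - a := by
  filter_upwards [eventually_gt_atTop (2 * |b| + |a| + 1)] with s hs
  have hb := le_abs_self b
  have ha := le_abs_self a
  have hb0 := abs_nonneg b
  have ha0 := abs_nonneg a
  nlinarith [mul_nonneg ha0 hb0]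

lemma tendsto_mul_inv_sqrt_quadratic (a b : ℝ) :
    Tendsto (fun s : ℝ => s * (Real.sqrt (s ^ 2 - 2 * b * s - a))⁻¹) atTop (nhds 1) := by
  have h : Tendsto (fun s : ℝ => (Real.sqrt (1 + -(2 * b + a * s⁻¹) * s⁻¹))⁻¹) atTop
      (nhds 1) := by
    have h₀ : Tendsto (fun s : ℝ => 1 + -(2 * b + a * s⁻¹) * s⁻¹) atTop (nhds 1) := by
      simpa using ((tendsto_add_mul_inv_atTop (2 * b) a).neg.mul
        tendsto_inv_atTop_zero).const_add 1
    simpa using h₀.sqrt.inv₀ (by simp)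
  refine h.congr' ?_
  filter_upwards [eventually_gt_atTop 0] with s hs
  have hq : s ^ 2 - 2 * b * s - a = s ^ 2 * (1 + -(2 * b + a * s⁻¹) * s⁻¹) := by
    field_simp
    ring
  rw [hq, Real.sqrt_mul (sq_nonneg s), Real.sqrt_sq hs.le, mul_inv, ← mul_assoc,
    mul_inv_cancel₀ hs.ne', one_mul]

lemma tendsto_sq_mul_inv_sqrt_quadratic_sub (a b : ℝ) :
    Tendsto (fun s : ℝ => s ^ 2 * ((Real.sqrt (s ^ 2 - 2 * b * s - a))⁻¹ - 1 / s)) atTop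
      (nhds b) := by
  have hr := tendsto_mul_inv_sqrt_quadratic a b
  have h := ((tendsto_add_mul_inv_atTop (2 * b) a).mul (hr.pow 2)).div (hr.add_const 1)
    (by norm_num)
  have hb : 2 * b * 1 ^ 2 / (1 + 1) = b := by ring
  rw [hb] at h
  refine h.congr' ?_
  filter_upwards [eventually_gt_atTop 0, eventually_quadratic_pos a b] with s hs hq
  have hsq := Real.sq_sqrt hq.le
  have hw := Real.sqrt_pos.2 hq
  simp only [Pi.div_apply]
  generalize Real.sqrt (s ^ 2 - 2 * b * s - a) = w at hsq hw ⊢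
  have hden : s * w⁻¹ + 1 ≠ 0 := by positivity
  rw [div_eq_iff hden]
  field_simp
  linear_combination hsq

/-- A timelike geodesic `s ↦ X + s P̃(k)` eventually enters the interior of the future
light cone; its Beig–Schmidt radial coordinate satisfies
`ρ(X + sP̃(k)) = 1/s + η(X,P̃(k))/s² + o(1/s²)`, and its Beig–Schmidt spatial coordinates
converge to `k`.  Hence the point `X` determines the cut `u = -η(X,P̃(y))` of `Ti⁺`. -/
theorem geodesic_reaches_ti_cut
    (n : ℕ) (hn : 1 ≤ n) (X : Fin (n+1) → ℝ) (k : Fin n → ℝ) :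
    (∃ s₀ : ℝ, 0 < s₀ ∧ ∀ s : ℝ, s₀ < s →
      0 < (X + s • hyp n k) 0 ∧
      minkowski n (X + s • hyp n k) (X + s • hyp n k) < 0) ∧
    Tendsto (fun s : ℝ => s ^ 2 * (rho n (X + s • hyp n k) - 1/s)) atTop
      (nhds (minkowski n X (hyp n k))) ∧
    Tendsto (fun s : ℝ => fun i : Fin n => rho n (X + s • hyp n k) * (X + s • hyp n k) i.succ)
      atTop (nhds k) := by
  have hrho : ∀ s : ℝ, rho n (X + s • hyp n k) =
      (Real.sqrt (s ^ 2 - 2 * minkowski n X (hyp n k) * s - minkowski n X X))⁻¹ := fun s => by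
    rw [rho, neg_minkowski_add_smul_hyp]
  refine ⟨?_, ?_, ?_⟩
  · have hc : 0 < hyp n k 0 := by
      simp only [hyp, Fin.cons_zero]
      positivity
    have htime : ∀ᶠ s : ℝ in atTop, 0 < X 0 + s * hyp n k 0 :=
      (tendsto_atTop_add_const_left _ _ (tendsto_id.atTop_mul_const hc)).eventually_gt_atTop 0
    obtain ⟨s₀, hs₀⟩ := eventually_atTop.1
      (htime.and (eventually_quadratic_pos (minkowski n X X) (minkowski n X (hyp n k))))
    refine ⟨max s₀ 1, by positivity, fun s hs => ?_⟩
    obtain ⟨h₀, h₁⟩ := hs₀ s ((le_max_left _ _).trans hs.le)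
    refine ⟨by simpa using h₀, ?_⟩
    rwa [← neg_minkowski_add_smul_hyp, neg_pos] at h₁
  · simpa only [hrho] using tendsto_sq_mul_inv_sqrt_quadratic_sub _ _
  · refine tendsto_pi_nhds.2 fun i => ?_
    have h := (tendsto_mul_inv_sqrt_quadratic (minkowski n X X) (minkowski n X (hyp n k))).mul
      (tendsto_add_mul_inv_atTop (k i) (X i.succ))
    rw [one_mul] at h
    refine h.congr' ?_
    filter_upwards [eventually_gt_atTop 0] with s hs
    have hk : hyp n k i.succ = k i := by simp only [hyp, Fin.cons_succ]
    simp only [hrho, Pi.add_apply, Pi.smul_apply, smul_eq_mul, hk]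
    field_simp
    ring
end
end

section
/- Let n ≥ 1. For (Λ,T) in the orthochronous Poincaré group G and (u,y) ∈ ℝ × ℝ^n, define (Λ,T)·(u,y) := ( u − η(T, P̃(φ_Λ(y))), φ_Λ(y) ). Then: (i) this is well defined, i.e. for every orthochronous Lorentz Λ and y ∈ ℝ^n the vector ΛP̃(y) has positive time component and equals P̃(y') for a unique y' = φ_Λ(y) ∈ ℝ^n; (ii) the formula defines a group action of G on ℝ × ℝ^n, i.e. (Λ₁,T₁)·((Λ₂,T₂)·(u,y)) = ((Λ₁Λ₂, T₁+Λ₁T₂))·(u,y); (iii) the action is transitive. -/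
open scoped BigOperators
open Filter MeasureTheory
open scoped Matrix

noncomputable section

/-- The Minkowski metric as a matrix, `η = diag(-1, 1, …, 1)`. -/
def etaMat (n : ℕ) : Matrix (Fin (n+1)) (Fin (n+1)) ℝ :=
  Matrix.diagonal (fun i => if i = 0 then (-1 : ℝ) else 1)

/-- An orthochronous Lorentz transformation: `Λᵀ η Λ = η` and `Λ⁰⁰ > 0`. -/
def IsOrthochronousLorentz (n : ℕ) (Λ : Matrix (Fin (n+1)) (Fin (n+1)) ℝ) : Prop :=
  Λᵀ * etaMat n * Λ = etaMat n ∧ 0 < Λ 0 0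

/-- The map `φ_Λ` induced by a Lorentz transformation on the hyperboloid chart:
the spatial part of `Λ P̃(y)`. -/
def lorentzBdy (n : ℕ) (Λ : Matrix (Fin (n+1)) (Fin (n+1)) ℝ) (y : Fin n → ℝ) : Fin n → ℝ :=
  fun i => Λ.mulVec (hyp n y) i.succ

/-- The Poincaré action on `Ti ≅ ℝ × ℝⁿ`:
`(Λ,T)·(u,y) = (u - η(T, P̃(φ_Λ(y))), φ_Λ(y))`. -/
def poincAct (n : ℕ) (Λ : Matrix (Fin (n+1)) (Fin (n+1)) ℝ) (T : Fin (n+1) → ℝ)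
    (p : ℝ × (Fin n → ℝ)) : ℝ × (Fin n → ℝ) :=
  (p.1 - minkowski n T (hyp n (lorentzBdy n Λ p.2)), lorentzBdy n Λ p.2)

theorem minkowski_eq_dotProduct (n : ℕ) (X Y : Fin (n+1) → ℝ) :
    minkowski n X Y = X ⬝ᵥ etaMat n *ᵥ Y := by
  simp [minkowski, etaMat, dotProduct, Fin.sum_univ_succ, Matrix.mulVec_diagonal, Fin.succ_ne_zero]

theorem etaMat_mul_self (n : ℕ) : etaMat n * etaMat n = 1 := by
  rw [etaMat, Matrix.diagonal_mul_diagonal, ← Matrix.diagonal_one]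
  congr 1
  ext i
  split_ifs <;> simp

theorem etaMat_transpose (n : ℕ) : (etaMat n)ᵀ = etaMat n :=
  Matrix.diagonal_transpose _

theorem minkowski_comm (n : ℕ) (X Y : Fin (n+1) → ℝ) : minkowski n X Y = minkowski n Y X := by
  simp only [minkowski, mul_comm]

theorem minkowski_add_left (n : ℕ) (X Y Z : Fin (n+1) → ℝ) :
    minkowski n (X + Y) Z = minkowski n X Z + minkowski n Y Z := by
  simp only [minkowski_eq_dotProduct, add_dotProduct]

theorem minkowski_smul_left (n : ℕ) (c : ℝ) (X Y : Fin (n+1) → ℝ) :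
    minkowski n (c • X) Y = c * minkowski n X Y := by
  simp only [minkowski_eq_dotProduct, smul_dotProduct, smul_eq_mul]

/-- Two future-directed timelike vectors have negative Minkowski product. -/
theorem minkowski_neg_of_timelike (n : ℕ) {X Y : Fin (n+1) → ℝ} (hX₀ : 0 < X 0) (hY₀ : 0 < Y 0)
    (hX : minkowski n X X < 0) (hY : minkowski n Y Y < 0) : minkowski n X Y < 0 := by
  have hcs := Finset.sum_mul_sq_le_sq_mul_sq Finset.univ
    (fun i : Fin n => X i.succ) (fun i => Y i.succ)
  simp only [minkowski, ← pow_two] at hX hY ⊢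
  have hA : 0 ≤ ∑ i : Fin n, X i.succ ^ 2 := Finset.sum_nonneg fun i _ => sq_nonneg _
  have hB : 0 ≤ ∑ i : Fin n, Y i.succ ^ 2 := Finset.sum_nonneg fun i _ => sq_nonneg _
  have hlt : (∑ i : Fin n, X i.succ * Y i.succ) ^ 2 < (X 0 * Y 0) ^ 2 := by
    rw [mul_pow]
    exact hcs.trans_lt (mul_lt_mul'' (by linarith) (by linarith) hA hB)
  linarith [lt_of_pow_lt_pow_left₀ 2 (mul_pos hX₀ hY₀).le hlt]

theorem hyp_zero_pos (n : ℕ) (y : Fin n → ℝ) : 0 < hyp n y 0 :=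
  Real.sqrt_pos.2 (by positivity)

theorem minkowski_hyp_self (n : ℕ) (y : Fin n → ℝ) : minkowski n (hyp n y) (hyp n y) = -1 := by
  have h : 0 ≤ 1 + ∑ i, y i ^ 2 := by positivity
  simp only [minkowski, hyp, Fin.cons_zero, Fin.cons_succ, Real.mul_self_sqrt h, ← pow_two]
  ring

theorem hyp_injective (n : ℕ) : Function.Injective (hyp n) := fun y y' h => by
  ext i
  simpa [hyp] using congrFun h i.succ

/-- Future-directed unit timelike vectors lie on the hyperboloid. -/
theorem hyp_spatial_eq (n : ℕ) {X : Fin (n+1) → ℝ} (hX₀ : 0 < X 0) (hX : minkowski n X X = -1) :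
    hyp n (fun i => X i.succ) = X := by
  ext i
  refine Fin.cases ?_ (fun j => rfl) i
  simp only [minkowski, ← pow_two] at hX
  rw [hyp, Fin.cons_zero, show 1 + ∑ i : Fin n, X i.succ ^ 2 = X 0 ^ 2 by linarith,
    Real.sqrt_sq hX₀.le]

namespace IsOrthochronousLorentz

variable {n : ℕ} {Λ : Matrix (Fin (n+1)) (Fin (n+1)) ℝ}

theorem minkowski_mulVec (h : IsOrthochronousLorentz n Λ) (X Y : Fin (n+1) → ℝ) :
    minkowski n (Λ *ᵥ X) (Λ *ᵥ Y) = minkowski n X Y := by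
  have hmul : etaMat n *ᵥ Y = Λᵀ *ᵥ (etaMat n *ᵥ (Λ *ᵥ Y)) := by
    rw [Matrix.mulVec_mulVec, Matrix.mulVec_mulVec, h.1]
  rw [minkowski_eq_dotProduct, minkowski_eq_dotProduct, hmul, Matrix.dotProduct_mulVec X,
    Matrix.vecMul_transpose]

theorem mul_etaMat_mul_transpose (h : IsOrthochronousLorentz n Λ) :
    Λ * etaMat n * Λᵀ = etaMat n := by
  have h₁ : (etaMat n * Λᵀ * etaMat n) * Λ = 1 := by
    rw [Matrix.mul_assoc, Matrix.mul_assoc, ← Matrix.mul_assoc Λᵀ, h.1, etaMat_mul_self]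
  have h₂ := congrArg (· * etaMat n) (mul_eq_one_comm.1 h₁)
  simpa only [Matrix.mul_assoc, etaMat_mul_self, Matrix.mul_one, Matrix.one_mul] using h₂

theorem mulVec_hyp_zero_pos (h : IsOrthochronousLorentz n Λ) (y : Fin n → ℝ) :
    0 < (Λ *ᵥ hyp n y) 0 := by
  let X : Fin (n+1) → ℝ := Fin.cons (Λ 0 0) fun i => -Λ 0 i.succ
  have hX : minkowski n X X = -1 := by
    have h₀ := congrFun (congrFun h.mul_etaMat_mul_transpose 0) 0
    rw [Matrix.mul_apply] at h₀
    simpa [etaMat, Matrix.mul_diagonal, Fin.sum_univ_succ, Fin.succ_ne_zero, minkowski, X] using h₀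
  have hneg := minkowski_neg_of_timelike n (X := X) h.2 (hyp_zero_pos n y)
    (by rw [hX]; norm_num) (by rw [minkowski_hyp_self]; norm_num)
  have hrow : minkowski n X (hyp n y) = -(Λ *ᵥ hyp n y) 0 := by
    simp [minkowski, X, Matrix.mulVec, dotProduct, Fin.sum_univ_succ]
    ring
  linarith

theorem hyp_lorentzBdy (h : IsOrthochronousLorentz n Λ) (y : Fin n → ℝ) :
    hyp n (lorentzBdy n Λ y) = Λ *ᵥ hyp n y :=
  hyp_spatial_eq n (h.mulVec_hyp_zero_pos y) (by rw [h.minkowski_mulVec, minkowski_hyp_self])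

end IsOrthochronousLorentz

/-- The Lorentz transformation fixing the line through `v` and acting by `-1` on its Minkowski
orthogonal complement. -/
def lineReflection (n : ℕ) (v : Fin (n+1) → ℝ) : Matrix (Fin (n+1)) (Fin (n+1)) ℝ :=
  (2 / minkowski n v v) • Matrix.vecMulVec v (etaMat n *ᵥ v) - 1

theorem lineReflection_mulVec (n : ℕ) (v X : Fin (n+1) → ℝ) :
    lineReflection n v *ᵥ X = (2 * minkowski n v X / minkowski n v v) • v - X := by
  rw [lineReflection, Matrix.sub_mulVec, Matrix.one_mulVec, Matrix.smul_mulVec,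
    Matrix.vecMulVec_mulVec, minkowski_comm n v X, minkowski_eq_dotProduct n X v,
    dotProduct_comm X]
  ext i
  simp
  ring

theorem isOrthochronousLorentz_lineReflection (n : ℕ) {v : Fin (n+1) → ℝ}
    (hv : minkowski n v v < 0) : IsOrthochronousLorentz n (lineReflection n v) := by
  constructor
  · have hc : 2 / minkowski n v v * minkowski n v v = 2 := div_mul_cancel₀ _ hv.ne
    set c := 2 / minkowski n v v with hcdef
    have hL : etaMat n * Matrix.vecMulVec v (etaMat n *ᵥ v)
        = Matrix.vecMulVec (etaMat n *ᵥ v) (etaMat n *ᵥ v) := Matrix.mul_vecMulVec _ _ _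
    have hR : Matrix.vecMulVec (etaMat n *ᵥ v) v * etaMat n
        = Matrix.vecMulVec (etaMat n *ᵥ v) (etaMat n *ᵥ v) := by
      rw [Matrix.vecMulVec_mul, ← Matrix.mulVec_transpose, etaMat_transpose]
    have hM : Matrix.vecMulVec (etaMat n *ᵥ v) (etaMat n *ᵥ v)
          * Matrix.vecMulVec v (etaMat n *ᵥ v)
        = minkowski n v v • Matrix.vecMulVec (etaMat n *ᵥ v) (etaMat n *ᵥ v) := by
      rw [Matrix.vecMulVec_mul_vecMulVec, dotProduct_comm, ← minkowski_eq_dotProduct,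
        Matrix.vecMulVec_smul]
    rw [lineReflection, ← hcdef, Matrix.transpose_sub, Matrix.transpose_smul,
      Matrix.transpose_vecMulVec, Matrix.transpose_one]
    simp only [sub_mul, mul_sub, Matrix.smul_mul, Matrix.mul_smul, Matrix.one_mul, Matrix.mul_one,
      hL, hR, hM, smul_smul, hc]
    module
  · have hpos : 0 ≤ ∑ i : Fin n, v i.succ ^ 2 := Finset.sum_nonneg fun i _ => sq_nonneg _
    have hentry : lineReflection n v 0 0 = 2 * v 0 ^ 2 / -minkowski n v v - 1 := by
      simp [lineReflection, Matrix.vecMulVec_apply, etaMat, Matrix.mulVec_diagonal, div_neg]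
      ring
    rw [hentry, sub_pos, lt_div_iff₀ (by linarith)]
    simp only [minkowski, ← pow_two] at hv ⊢
    linarith

/-- Orthochronous Lorentz transformations act transitively on the hyperboloid. -/
theorem exists_lorentz_mulVec_hyp_eq (n : ℕ) (y y' : Fin n → ℝ) :
    ∃ Λ, IsOrthochronousLorentz n Λ ∧ Λ *ᵥ hyp n y = hyp n y' := by
  have hab := minkowski_neg_of_timelike n (hyp_zero_pos n y) (hyp_zero_pos n y')
    (by rw [minkowski_hyp_self]; norm_num) (by rw [minkowski_hyp_self]; norm_num)
  have hva : minkowski n (hyp n y + hyp n y') (hyp n y)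
      = minkowski n (hyp n y) (hyp n y') - 1 := by
    rw [minkowski_add_left, minkowski_hyp_self, minkowski_comm n (hyp n y')]
    ring
  have hvv : minkowski n (hyp n y + hyp n y') (hyp n y + hyp n y')
      = 2 * (minkowski n (hyp n y) (hyp n y') - 1) := by
    rw [minkowski_add_left, minkowski_comm n _ (hyp n y + hyp n y'),
      minkowski_comm n _ (hyp n y + hyp n y'), hva, minkowski_add_left, minkowski_hyp_self]
    ring
  refine ⟨lineReflection n (hyp n y + hyp n y'),
    isOrthochronousLorentz_lineReflection n (by rw [hvv]; linarith), ?_⟩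
  rw [lineReflection_mulVec, hva, hvv, div_self (by linarith), one_smul, add_sub_cancel_left]

/-- The formula `(Λ,T)·(u,y) = (u - η(T,P̃(φ_Λ(y))), φ_Λ(y))` is well defined
(`ΛP̃(y)` is again a point of the future hyperboloid, `P̃(y')` for a unique `y'`),
and defines a transitive action of the orthochronous Poincaré group on `ℝ × ℝⁿ`. -/
theorem poincare_acts_transitively_on_Ti (n : ℕ) (hn : 1 ≤ n) :
    (∀ Λ : Matrix (Fin (n+1)) (Fin (n+1)) ℝ, IsOrthochronousLorentz n Λ →
      ∀ y : Fin n → ℝ,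
        0 < Λ.mulVec (hyp n y) 0 ∧
        hyp n (lorentzBdy n Λ y) = Λ.mulVec (hyp n y) ∧
        (∃! y' : Fin n → ℝ, hyp n y' = Λ.mulVec (hyp n y))) ∧
    (∀ p : ℝ × (Fin n → ℝ), poincAct n 1 0 p = p) ∧
    (∀ (Λ₁ : Matrix (Fin (n+1)) (Fin (n+1)) ℝ) (T₁ : Fin (n+1) → ℝ)
        (Λ₂ : Matrix (Fin (n+1)) (Fin (n+1)) ℝ) (T₂ : Fin (n+1) → ℝ),
      IsOrthochronousLorentz n Λ₁ → IsOrthochronousLorentz n Λ₂ →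
      ∀ p : ℝ × (Fin n → ℝ),
        poincAct n Λ₁ T₁ (poincAct n Λ₂ T₂ p)
          = poincAct n (Λ₁ * Λ₂) (T₁ + Λ₁.mulVec T₂) p) ∧
    (∀ p q : ℝ × (Fin n → ℝ), ∃ (Λ : Matrix (Fin (n+1)) (Fin (n+1)) ℝ) (T : Fin (n+1) → ℝ),
      IsOrthochronousLorentz n Λ ∧ poincAct n Λ T p = q) := by
  refine ⟨fun Λ h y => ⟨h.mulVec_hyp_zero_pos y, h.hyp_lorentzBdy y, lorentzBdy n Λ y,
    h.hyp_lorentzBdy y, fun z hz => hyp_injective n (hz.trans (h.hyp_lorentzBdy y).symm)⟩,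
    fun p => ?_, fun Λ₁ T₁ Λ₂ T₂ h₁ h₂ p => ?_, fun p q => ?_⟩
  · have hφ : lorentzBdy n 1 p.2 = p.2 := by
      ext i
      simp [lorentzBdy, hyp]
    simp [poincAct, hφ, minkowski]
  · have hφ : lorentzBdy n (Λ₁ * Λ₂) p.2 = lorentzBdy n Λ₁ (lorentzBdy n Λ₂ p.2) := by
      ext i
      simp only [lorentzBdy]
      rw [← Matrix.mulVec_mulVec, ← h₂.hyp_lorentzBdy]
    have hT : minkowski n (Λ₁ *ᵥ T₂) (hyp n (lorentzBdy n Λ₁ (lorentzBdy n Λ₂ p.2)))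
        = minkowski n T₂ (hyp n (lorentzBdy n Λ₂ p.2)) := by
      rw [h₁.hyp_lorentzBdy, h₁.minkowski_mulVec]
    simp only [poincAct, hφ, minkowski_add_left, hT, Prod.mk.injEq, and_true]
    ring
  · obtain ⟨Λ, hΛ, hmap⟩ := exists_lorentz_mulVec_hyp_eq n p.2 q.2
    have hφ : lorentzBdy n Λ p.2 = q.2 := hyp_injective n ((hΛ.hyp_lorentzBdy p.2).trans hmap)
    refine ⟨Λ, (q.1 - p.1) • hyp n q.2, hΛ, ?_⟩
    rw [poincAct, hφ, minkowski_smul_left, minkowski_hyp_self]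
    ext <;> simp
end
end
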